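/- Let (G_1, A_1, B_1) and (G_2, A_2, B_2) be splitted graphs with disjoint vertex sets, and let (F, A_1 ∪ A_2, B_1 ∪ B_2) be their composition (G_1, A_1, B_1) ∘ (G_2, A_2, B_2). Then scw(F, A_1 ∪ A_2, B_1 ∪ B_2) ≤ max{4, scw(G_1, A_1, B_1), scw(G_2, A_2, B_2)}. -/

import Mathlib

namespace CWPaper

/-! ## Clique-width expressions -/

/-- Syntax of clique-width expressions.  Labels are natural numbers (`0`-indexed, so a
`k`-expression uses labels `0, …, k-1`). -/
inductive Expr : Type
  | vert : ℕ → Expr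
  | union : Expr → Expr → Expr
  | join : ℕ → ℕ → Expr → Expr
  | relabel : ℕ → ℕ → Expr → Expr

namespace Expr

/-- The vertex set of an expression: one vertex per `vert` leaf. -/
def Verts : Expr → Type
  | vert _ => Unit
  | union a b => Verts a ⊕ Verts b
  | join _ _ a => Verts a
  | relabel _ _ a => Verts a

/-- The label of each vertex after evaluating the expression. -/
def label : (e : Expr) → e.Verts → ℕ
  | vert i, _ => i
  | union a b, v => Sum.elim a.label b.label v
  | join _ _ a, v => a.label v
  | relabel i j a, v => if a.label v = i then j else a.label v

/-- The adjacency relation of the labeled graph built by the expression. -/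
def adj : (e : Expr) → e.Verts → e.Verts → Prop
  | vert _, _, _ => False
  | union a b, u, v =>
      match u, v with
      | .inl u, .inl v => a.adj u v
      | .inr u, .inr v => b.adj u v
      | _, _ => False
  | join i j a, u, v =>
      a.adj u v ∨ (a.label u = i ∧ a.label v = j) ∨ (a.label u = j ∧ a.label v = i)
  | relabel _ _ a, u, v => a.adj u v

/-- `e` is a `k`-expression: all labels used are among `0, …, k-1`, and joins use two
distinct labels. -/
def Valid (k : ℕ) : Expr → Prop
  | vert i => i < k
  | union a b => Valid k a ∧ Valid k b
  | join i j a => i < k ∧ j < k ∧ i ≠ j ∧ Valid k a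
  | relabel i j a => i < k ∧ j < k ∧ Valid k a

/-- The expression `e` constructs the simple graph `G` (the final labels are ignored). -/
def Constructs (e : Expr) {V : Type*} (G : SimpleGraph V) : Prop :=
  ∃ f : e.Verts ≃ V, ∀ u v, G.Adj (f u) (f v) ↔ e.adj u v

/-- The expression `e` constructs the graph `G` *split labeled* with respect to `(A, B)`:
every vertex of `A` ends with the first label (encoded `0`) and every vertex of `B` ends
with the second label (encoded `1`). -/
def ConstructsSplit (e : Expr) {V : Type*} (G : SimpleGraph V) (A B : Set V) : Prop :=
  ∃ f : e.Verts ≃ V, (∀ u v, G.Adj (f u) (f v) ↔ e.adj u v) ∧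
    ∀ u, (f u ∈ A → e.label u = 0) ∧ (f u ∈ B → e.label u = 1)

end Expr

/-- The clique-width of a graph: the least `k` such that some `k`-expression constructs it. -/
noncomputable def cliqueWidth {V : Type*} (G : SimpleGraph V) : ℕ :=
  sInf {k | ∃ e : Expr, e.Valid k ∧ e.Constructs G}

/-- The split clique-width of a splitted graph `(G, A, B)`: the least `k` such that some
`k`-expression constructs `G` split labeled. -/
noncomputable def splitCliqueWidth {V : Type*} (G : SimpleGraph V) (A B : Set V) : ℕ :=
  sInf {k | ∃ e : Expr, e.Valid k ∧ e.ConstructsSplit G A B}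

/-! ## Splitted graphs and compositions -/

/-- `(G, A, B)` is a splitted graph: `A` and `B` partition the vertex set, `A` is a clique
and `B` is an independent set. -/
def IsSplitted {V : Type*} (G : SimpleGraph V) (A B : Set V) : Prop :=
  A ∪ B = Set.univ ∧ Disjoint A B ∧
    (∀ a ∈ A, ∀ b ∈ A, a ≠ b → G.Adj a b) ∧ (∀ a ∈ B, ∀ b ∈ B, ¬ G.Adj a b)

/-- The composition `(G, A, B) ∘ H` of a splitted graph with a graph `H` on a disjoint
vertex set: take the disjoint union and add all edges between `A` and `V(H)`. -/
def comp {U W : Type*} (G : SimpleGraph U) (A : Set U) (H : SimpleGraph W) :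
    SimpleGraph (U ⊕ W) :=
  SimpleGraph.fromRel fun x y =>
    match x, y with
    | .inl a, .inl b => G.Adj a b
    | .inr a, .inr b => H.Adj a b
    | .inl a, .inr _ => a ∈ A
    | .inr _, .inl _ => False

/-- Inverting a splitted graph `(G, A, B)`: remove all edges inside `A` and add all edges
inside `B`.  The inverse splitted graph is `(splitInverse G A B, B, A)`. -/
def splitInverse {V : Type*} (G : SimpleGraph V) (A B : Set V) : SimpleGraph V :=
  SimpleGraph.fromRel fun x y =>
    (G.Adj x y ∧ ¬(x ∈ A ∧ y ∈ A)) ∨ (x ∈ B ∧ y ∈ B)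

/-! ## Unigraphs -/

/-- The multiset of vertex degrees of a finite graph. -/
noncomputable def degreeMultiset (V : Type*) [Fintype V] (G : SimpleGraph V) : Multiset ℕ :=
  (Finset.univ.val : Multiset V).map fun v => (G.neighborSet v).ncard

/-- A finite graph is a unigraph if every finite graph with the same degree multiset is
isomorphic to it. -/
def IsUnigraph {V : Type u} [Fintype V] (G : SimpleGraph V) : Prop :=
  ∀ (W : Type u) (_ : Fintype W) (H : SimpleGraph W),
    degreeMultiset W H = degreeMultiset V G → Nonempty (G ≃g H)

/-! ## Concrete graphs -/

/-- `mK2 m` : the disjoint union of `m` copies of `K₂`. -/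
def mK2 (m : ℕ) : SimpleGraph (Fin m × Fin 2) :=
  SimpleGraph.fromRel fun x y => x.1 = y.1

/-- The star `K_{1,s}`; `none` is the center and the `some i` are the leaves. -/
def starG (s : ℕ) : SimpleGraph (Option (Fin s)) :=
  SimpleGraph.fromRel fun x _ => x = none

/-- `U2 m s` : the disjoint union of `mK₂` and the star `K_{1,s}`. -/
def U2 (m s : ℕ) : SimpleGraph ((Fin m × Fin 2) ⊕ Option (Fin s)) :=
  SimpleGraph.fromRel fun x y =>
    match x, y with
    | .inl a, .inl b => a.1 = b.1
    | .inr a, .inr _ => a = none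
    | _, _ => False

/-- `U3 m` : the disjoint union of `C₄` and `m` triangles with one vertex of each
component identified into the hub `none`.  The vertices `some (Sum.inl i)`, `i = 0, 1, 2`,
are the remaining path of the `C₄` (so the hub is joined to its two endpoints), and
`some (Sum.inr (i, x))` are the two remaining vertices of the `i`-th triangle. -/
def U3 (m : ℕ) : SimpleGraph (Option (Fin 3 ⊕ Fin m × Fin 2)) :=
  SimpleGraph.fromRel fun x y =>
    match x, y with
    | none, some (.inl i) => i ≠ 1
    | none, some (.inr _) => True
    | some (.inl i), some (.inl j) => (i : ℕ) + 1 = (j : ℕ)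
    | some (.inr a), some (.inr b) => a.1 = b.1
    | _, _ => False

/-- A graph is `P₄`-free if no four vertices induce a path on four vertices. -/
def P4Free {V : Type*} (G : SimpleGraph V) : Prop :=
  IsEmpty (SimpleGraph.pathGraph 4 ↪g G)

/-! ## The split unigraphs `S₂`, `S₃`, `S₄` -/

/-- Vertices of `S₂`: the centers `Sum.inl ⟨i, j⟩` (`j`-th center of multiplicity block `i`)
and the leaves `Sum.inr ⟨i, j, x⟩` (`x`-th leaf of the star with center `⟨i, j⟩`). -/
def S2Verts (t : ℕ) (p q : Fin t → ℕ) : Type :=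
  (Σ i : Fin t, Fin (q i)) ⊕ (Σ i : Fin t, Fin (q i) × Fin (p i))

/-- The center of the star a leaf belongs to. -/
def leafCenter {t : ℕ} {p q : Fin t → ℕ} (e : Σ i : Fin t, Fin (q i) × Fin (p i)) :
    Σ i : Fin t, Fin (q i) :=
  ⟨e.1, e.2.1⟩

/-- The split graph `S₂(p₁, q₁; …; p_t, q_t)`: for each `i`, take `q i` disjoint stars
`K_{1, p i}` and join every two centers.  The clique is the set of centers
(`Set.range Sum.inl`) and the independent set is the set of leaves (`Set.range Sum.inr`). -/
def S2 (t : ℕ) (p q : Fin t → ℕ) : SimpleGraph (S2Verts t p q) :=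
  SimpleGraph.fromRel fun x y =>
    match x, y with
    | .inl _, .inl _ => True
    | .inl c, .inr e => leafCenter e = c
    | _, _ => False

/-- The split graph `S₃(p, q₁; q₂)`: add to `S₂(p, q₁; p+1, q₂)` a new independent vertex
`none` joined to exactly the `q₁` centers of the stars `K_{1,p}`. -/
def S3 (p q1 q2 : ℕ) : SimpleGraph (Option (S2Verts 2 ![p, p + 1] ![q1, q2])) :=
  SimpleGraph.fromRel fun x y =>
    match x, y with
    | some a, some b => (S2 2 ![p, p + 1] ![q1, q2]).Adj a b
    | none, some (.inl c) => c.1 = 0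
    | _, _ => False

/-- The clique of the splitted graph `S₃(p, q₁; q₂)` (the star centers). -/
def S3A (p q1 q2 : ℕ) : Set (Option (S2Verts 2 ![p, p + 1] ![q1, q2])) :=
  {x | ∃ c, x = some (Sum.inl c)}

/-- The independent set of the splitted graph `S₃(p, q₁; q₂)` (the leaves and the extra
vertex `none`). -/
def S3B (p q1 q2 : ℕ) : Set (Option (S2Verts 2 ![p, p + 1] ![q1, q2])) :=
  {x | x = none ∨ ∃ e, x = some (Sum.inr e)}

/-- The split graph `S₄(p, q)`: add to `S₃(p, 2; q)` a new clique vertex (the outer `none`)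
joined to every vertex except itself and the special vertex `v` of `S₃` (here `some none`). -/
def S4 (p q : ℕ) : SimpleGraph (Option (Option (S2Verts 2 ![p, p + 1] ![2, q]))) :=
  SimpleGraph.fromRel fun x y =>
    match x, y with
    | some a, some b => (S3 p 2 q).Adj a b
    | none, some (some _) => True
    | _, _ => False

/-- The clique of the splitted graph `S₄(p, q)` (the star centers and the new vertex `u`). -/
def S4A (p q : ℕ) : Set (Option (Option (S2Verts 2 ![p, p + 1] ![2, q]))) :=
  {x | x = none ∨ ∃ c, x = some (some (Sum.inl c))}

/-- The independent set of the splitted graph `S₄(p, q)` (the leaves and the vertex `v`). -/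
def S4B (p q : ℕ) : Set (Option (Option (S2Verts 2 ![p, p + 1] ![2, q]))) :=
  {x | x = some none ∨ ∃ e, x = some (some (Sum.inr e))}

/-! ## Induced subgraphs of constructed graphs -/

/-- Deleting leaves from an expression constructs any nonempty induced labeled subgraph. -/
theorem Expr.exists_restrict (e : Expr) (S : Set e.Verts) (hS : S.Nonempty) :
    ∃ (e' : Expr) (h : e'.Verts → e.Verts), Function.Injective h ∧ Set.range h = S ∧
      (∀ k, e.Valid k → e'.Valid k) ∧ (∀ u v, e'.adj u v ↔ e.adj (h u) (h v)) ∧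
      ∀ u, e'.label u = e.label (h u) := by
  induction e with
  | vert i =>
    refine ⟨vert i, id, Function.injective_id, ?_, fun _ hk => hk, fun _ _ => Iff.rfl,
      fun _ => rfl⟩
    obtain ⟨x, hx⟩ := hS
    ext y
    simpa using (show y ∈ S from hx)
  | union a b iha ihb =>
    by_cases h₁ : (Sum.inl ⁻¹' S : Set a.Verts).Nonempty
    · obtain ⟨a', f, hf, hfS, hav, haa, hal⟩ := iha _ h₁
      by_cases h₂ : (Sum.inr ⁻¹' S : Set b.Verts).Nonempty
      · obtain ⟨b', g, hg, hgS, hbv, hba, hbl⟩ := ihb _ h₂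
        refine ⟨union a' b', Sum.map f g, hf.sumMap hg, ?_,
          fun k hk => ⟨hav k hk.1, hbv k hk.2⟩, ?_, ?_⟩
        · ext (x | x)
          · refine Iff.trans ?_ (Set.ext_iff.1 hfS x)
            constructor
            · rintro ⟨y | y, hy⟩
              · exact ⟨y, Sum.inl_injective hy⟩
              · cases hy
            · rintro ⟨y, rfl⟩
              exact ⟨Sum.inl y, rfl⟩
          · refine Iff.trans ?_ (Set.ext_iff.1 hgS x)
            constructor
            · rintro ⟨y | y, hy⟩
              · cases hy
              · exact ⟨y, Sum.inr_injective hy⟩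
            · rintro ⟨y, rfl⟩
              exact ⟨Sum.inr y, rfl⟩
        · rintro (u | u) (v | v)
          · exact haa u v
          · exact Iff.rfl
          · exact Iff.rfl
          · exact hba u v
        · rintro (u | u)
          · exact hal u
          · exact hbl u
      · refine ⟨a', fun u => Sum.inl (f u), Sum.inl_injective.comp hf, ?_,
          fun k hk => hav k hk.1, haa, hal⟩
        ext (x | x)
        · refine Iff.trans ?_ (Set.ext_iff.1 hfS x)
          exact exists_congr fun y => Sum.inl_injective.eq_iff
        · exact iff_of_false (by rintro ⟨y, hy⟩; cases hy) fun hx => h₂ ⟨x, hx⟩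
    · have h₂ : (Sum.inr ⁻¹' S : Set b.Verts).Nonempty := by
        obtain ⟨x | x, hx⟩ := hS
        · exact absurd ⟨x, hx⟩ h₁
        · exact ⟨x, hx⟩
      obtain ⟨b', g, hg, hgS, hbv, hba, hbl⟩ := ihb _ h₂
      refine ⟨b', fun u => Sum.inr (g u), Sum.inr_injective.comp hg, ?_,
        fun k hk => hbv k hk.2, hba, hbl⟩
      ext (x | x)
      · exact iff_of_false (by rintro ⟨y, hy⟩; cases hy) fun hx => h₁ ⟨x, hx⟩
      · refine Iff.trans ?_ (Set.ext_iff.1 hgS x)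
        exact exists_congr fun y => Sum.inr_injective.eq_iff
  | join i j a ih =>
    obtain ⟨a', f, hf, hfS, hv, ha, hl⟩ := ih S hS
    refine ⟨join i j a', f, hf, hfS, fun k hk => ⟨hk.1, hk.2.1, hk.2.2.1, hv k hk.2.2.2⟩,
      fun u v => ?_, hl⟩
    exact or_congr (ha u v) (by rw [hl u, hl v])
  | relabel i j a ih =>
    obtain ⟨a', f, hf, hfS, hv, ha, hl⟩ := ih S hS
    refine ⟨relabel i j a', f, hf, hfS, fun k hk => ⟨hk.1, hk.2.1, hv k hk.2.2⟩, ha,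
      fun u => ?_⟩
    change (if a'.label u = i then j else a'.label u) =
      if a.label (f u) = i then j else a.label (f u)
    rw [hl u]

theorem Expr.ConstructsSplit.exists_of_embedding {V V' : Type*} [Nonempty V] {e : Expr} {k : ℕ}
    {G : SimpleGraph V} {A B : Set V} {G' : SimpleGraph V'} {A' B' : Set V'}
    (he : e.ConstructsSplit G' A' B') (hk : e.Valid k) (φ : G ↪g G')
    (hA : ∀ v ∈ A, φ v ∈ A') (hB : ∀ v ∈ B, φ v ∈ B') :
    ∃ e' : Expr, e'.Valid k ∧ e'.ConstructsSplit G A B := by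
  obtain ⟨F, hadj, hlab⟩ := he
  obtain ⟨e', h, hinj, hrange, hv, ha, hl⟩ :=
    e.exists_restrict (Set.range fun v => F.symm (φ v)) (Set.range_nonempty _)
  have hex : ∀ u, ∃ v, φ v = F (h u) := fun u => by
    obtain ⟨v, hv⟩ := hrange.subset ⟨u, rfl⟩
    exact ⟨v, by rw [← hv]; simp⟩
  choose g hg using hex
  have hbij : Function.Bijective g := by
    refine ⟨fun u v huv => hinj (F.injective ?_), fun v => ?_⟩
    · rw [← hg, ← hg, huv]
    · obtain ⟨u, hu⟩ := hrange.superset ⟨v, rfl⟩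
      refine ⟨u, φ.injective ?_⟩
      rw [hg, hu]
      simp
  refine ⟨e', hv k hk, Equiv.ofBijective g hbij, fun u v => ?_,
    fun u => ⟨fun hu => ?_, fun hu => ?_⟩⟩
  · rw [ha, ← hadj, ← hg, ← hg]
    exact φ.map_adj_iff.symm
  · rw [hl]
    exact (hlab _).1 (hg u ▸ hA _ hu)
  · rw [hl]
    exact (hlab _).2 (hg u ▸ hB _ hu)

/-! ## Expressions for compositions -/

section comp

variable {U W : Type*} (G : SimpleGraph U) (A : Set U) (H : SimpleGraph W)

@[simp]
theorem comp_adj_inl_inl (a b : U) : (comp G A H).Adj (.inl a) (.inl b) ↔ G.Adj a b := by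
  simp only [comp, SimpleGraph.fromRel_adj, G.adj_comm b a, or_self, ne_eq, Sum.inl.injEq]
  exact and_iff_right_of_imp fun h => h.ne

@[simp]
theorem comp_adj_inr_inr (a b : W) : (comp G A H).Adj (.inr a) (.inr b) ↔ H.Adj a b := by
  simp only [comp, SimpleGraph.fromRel_adj, H.adj_comm b a, or_self, ne_eq, Sum.inr.injEq]
  exact and_iff_right_of_imp fun h => h.ne

@[simp]
theorem comp_adj_inl_inr (a : U) (b : W) : (comp G A H).Adj (.inl a) (.inr b) ↔ a ∈ A := by
  simp [comp]

@[simp]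
theorem comp_adj_inr_inl (a : W) (b : U) : (comp G A H).Adj (.inr a) (.inl b) ↔ b ∈ A := by
  simp [comp]

/-- The first factor as an induced subgraph of a composition. -/
def compInl : G ↪g comp G A H where
  toEmbedding := .inl
  map_rel_iff' := comp_adj_inl_inl G A H _ _

/-- The second factor as an induced subgraph of a composition. -/
def compInr : H ↪g comp G A H where
  toEmbedding := .inr
  map_rel_iff' := comp_adj_inr_inr G A H _ _

/-- Composing with the empty graph changes nothing. -/
def compSumEmpty [IsEmpty W] : comp G A H ↪g G where
  toEmbedding := (Equiv.sumEmpty U W).toEmbedding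
  map_rel_iff' := by rintro (a | a) (b | b) <;> first | exact isEmptyElim ‹W› | simp

/-- Composing the empty splitted graph with a graph does not change that graph. -/
def compEmptySum [IsEmpty U] : comp G A H ↪g H where
  toEmbedding := (Equiv.emptySum U W).toEmbedding
  map_rel_iff' := by rintro (a | a) (b | b) <;> first | exact isEmptyElim ‹U› | simp

end comp

/-- Combines expressions for two split labeled graphs into one for their composition, using the
labels `2` and `3` to keep the first graph apart from the second. -/
def Expr.compose (a b : Expr) : Expr :=
  relabel 2 1 (relabel 3 0 (join 3 1 (join 3 0 (union (relabel 0 3 (relabel 1 2 a)) b))))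

theorem Expr.Valid.mono {k l : ℕ} (hkl : k ≤ l) {e : Expr} (he : e.Valid k) : e.Valid l := by
  induction e with
  | vert i => exact lt_of_lt_of_le he hkl
  | union a b iha ihb => exact ⟨iha he.1, ihb he.2⟩
  | join i j a ih => exact ⟨he.1.trans_le hkl, he.2.1.trans_le hkl, he.2.2.1, ih he.2.2.2⟩
  | relabel i j a ih => exact ⟨he.1.trans_le hkl, he.2.1.trans_le hkl, ih he.2.2⟩

theorem Expr.Valid.compose {k : ℕ} (hk : 4 ≤ k) {a b : Expr} (ha : a.Valid k) (hb : b.Valid k) :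
    (a.compose b).Valid k := by
  refine ⟨?_, ?_, ?_, ?_, ?_, ?_, ?_, ?_, ?_, ?_, ⟨?_, ?_, ?_, ?_, ha⟩, hb⟩ <;> omega

theorem Expr.ConstructsSplit.compose {U W : Type*} {G₁ : SimpleGraph U} {A₁ B₁ : Set U}
    {G₂ : SimpleGraph W} {A₂ B₂ : Set W} {e₁ e₂ : Expr}
    (h₁ : IsSplitted G₁ A₁ B₁) (h₂ : IsSplitted G₂ A₂ B₂)
    (he₁ : e₁.ConstructsSplit G₁ A₁ B₁) (he₂ : e₂.ConstructsSplit G₂ A₂ B₂) :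
    (e₁.compose e₂).ConstructsSplit (comp G₁ A₁ G₂) (Sum.inl '' A₁ ∪ Sum.inr '' A₂)
      (Sum.inl '' B₁ ∪ Sum.inr '' B₂) := by
  obtain ⟨f, hf, hfl⟩ := he₁
  obtain ⟨g, hg, hgl⟩ := he₂
  have key₁ : ∀ u, (f u ∈ A₁ ∧ f u ∉ B₁ ∧ e₁.label u = 0) ∨
      (f u ∉ A₁ ∧ f u ∈ B₁ ∧ e₁.label u = 1) := fun u => by
    rcases h₁.1.superset (Set.mem_univ (f u)) with h | h
    · exact .inl ⟨h, h₁.2.1.notMem_of_mem_left h, (hfl u).1 h⟩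
    · exact .inr ⟨h₁.2.1.notMem_of_mem_right h, h, (hfl u).2 h⟩
  have key₂ : ∀ u, (g u ∈ A₂ ∧ g u ∉ B₂ ∧ e₂.label u = 0) ∨
      (g u ∉ A₂ ∧ g u ∈ B₂ ∧ e₂.label u = 1) := fun u => by
    rcases h₂.1.superset (Set.mem_univ (g u)) with h | h
    · exact .inl ⟨h, h₂.2.1.notMem_of_mem_left h, (hgl u).1 h⟩
    · exact .inr ⟨h₂.2.1.notMem_of_mem_right h, h, (hgl u).2 h⟩
  refine ⟨Equiv.sumCongr f g, ?_, ?_⟩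
  · rintro (u | u) (v | v)
    · refine (comp_adj_inl_inl G₁ A₁ G₂ (f u) (f v)).trans ((hf u v).trans ?_)
      rcases key₁ u with ⟨-, -, hu⟩ | ⟨-, -, hu⟩ <;> rcases key₁ v with ⟨-, -, hv⟩ | ⟨-, -, hv⟩ <;>
        simp [Expr.compose, adj, label, hu, hv]
    · refine (comp_adj_inl_inr G₁ A₁ G₂ (f u) (g v)).trans ?_
      rcases key₁ u with ⟨hA, -, hu⟩ | ⟨hA, -, hu⟩ <;>
        rcases key₂ v with ⟨-, -, hv⟩ | ⟨-, -, hv⟩ <;>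
        simp [Expr.compose, adj, label, hu, hv, hA]
    · refine (comp_adj_inr_inl G₁ A₁ G₂ (g u) (f v)).trans ?_
      rcases key₂ u with ⟨-, -, hu⟩ | ⟨-, -, hu⟩ <;>
        rcases key₁ v with ⟨hA, -, hv⟩ | ⟨hA, -, hv⟩ <;>
        simp [Expr.compose, adj, label, hu, hv, hA]
    · refine (comp_adj_inr_inr G₁ A₁ G₂ (g u) (g v)).trans ((hg u v).trans ?_)
      rcases key₂ u with ⟨-, -, hu⟩ | ⟨-, -, hu⟩ <;> rcases key₂ v with ⟨-, -, hv⟩ | ⟨-, -, hv⟩ <;>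
        simp [Expr.compose, adj, label, hu, hv]
  · rintro (u | u)
    · change (Sum.inl (f u) ∈ _ → _) ∧ (Sum.inl (f u) ∈ _ → _)
      rcases key₁ u with ⟨hA, hB, hu⟩ | ⟨hA, hB, hu⟩ <;>
        simp [Expr.compose, label, hu, hA, hB]
    · change (Sum.inr (g u) ∈ _ → _) ∧ (Sum.inr (g u) ∈ _ → _)
      rcases key₂ u with ⟨hA, hB, hu⟩ | ⟨hA, hB, hu⟩ <;>
        simp [Expr.compose, label, hu, hA, hB]

theorem stmt2 {U W : Type} (G₁ : SimpleGraph U) (A₁ B₁ : Set U)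
    (G₂ : SimpleGraph W) (A₂ B₂ : Set W)
    (h₁ : IsSplitted G₁ A₁ B₁) (h₂ : IsSplitted G₂ A₂ B₂) :
    splitCliqueWidth (comp G₁ A₁ G₂) (Sum.inl '' A₁ ∪ Sum.inr '' A₂)
        (Sum.inl '' B₁ ∪ Sum.inr '' B₂) ≤
      max 4 (max (splitCliqueWidth G₁ A₁ B₁) (splitCliqueWidth G₂ A₂ B₂)) := by
  rcases Set.eq_empty_or_nonempty {k | ∃ e : Expr, e.Valid k ∧
      e.ConstructsSplit (comp G₁ A₁ G₂) (Sum.inl '' A₁ ∪ Sum.inr '' A₂)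
        (Sum.inl '' B₁ ∪ Sum.inr '' B₂)} with h | ⟨k, e, hk, he⟩
  · simp [splitCliqueWidth, h]
  have hV : Nonempty (U ⊕ W) := by
    obtain ⟨f, -⟩ := he
    have : ∀ e : Expr, Nonempty e.Verts := fun e => by
      induction e with
      | vert i => exact ⟨()⟩
      | union a b iha _ => exact iha.map Sum.inl
      | join i j a ih => exact ih
      | relabel i j a ih => exact ih
    exact (this e).map f
  have mem₁ : Nonempty U → ∃ e₁ : Expr, e₁.Valid (splitCliqueWidth G₁ A₁ B₁) ∧
      e₁.ConstructsSplit G₁ A₁ B₁ := fun _ =>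
    Nat.sInf_mem (s := {k | ∃ e : Expr, e.Valid k ∧ e.ConstructsSplit G₁ A₁ B₁})
      ⟨k, he.exists_of_embedding hk (compInl G₁ A₁ G₂)
        (fun v hv => .inl ⟨v, hv, rfl⟩) (fun v hv => .inl ⟨v, hv, rfl⟩)⟩
  have mem₂ : Nonempty W → ∃ e₂ : Expr, e₂.Valid (splitCliqueWidth G₂ A₂ B₂) ∧
      e₂.ConstructsSplit G₂ A₂ B₂ := fun _ =>
    Nat.sInf_mem (s := {k | ∃ e : Expr, e.Valid k ∧ e.ConstructsSplit G₂ A₂ B₂})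
      ⟨k, he.exists_of_embedding hk (compInr G₁ A₁ G₂)
        (fun v hv => .inr ⟨v, hv, rfl⟩) (fun v hv => .inr ⟨v, hv, rfl⟩)⟩
  apply Nat.sInf_le
  rcases isEmpty_or_nonempty U with hU | hU
  · obtain ⟨e₂, hk₂, he₂⟩ := mem₂ ((Equiv.emptySum U W).nonempty_congr.1 hV)
    refine he₂.exists_of_embedding (hk₂.mono (by simp)) (compEmptySum G₁ A₁ G₂) ?_ ?_
    all_goals
      rintro (v | v) hv
      · exact isEmptyElim v
      · change v ∈ _
        simpa using hv
  rcases isEmpty_or_nonempty W with hW | hW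
  · obtain ⟨e₁, hk₁, he₁⟩ := mem₁ hU
    refine he₁.exists_of_embedding (hk₁.mono (by simp)) (compSumEmpty G₁ A₁ G₂) ?_ ?_
    all_goals
      rintro (v | v) hv
      · change v ∈ _
        simpa using hv
      · exact isEmptyElim v
  obtain ⟨e₁, hk₁, he₁⟩ := mem₁ hU
  obtain ⟨e₂, hk₂, he₂⟩ := mem₂ hW
  exact ⟨e₁.compose e₂, .compose (le_max_left _ _) (hk₁.mono (by simp)) (hk₂.mono (by simp)),
    .compose h₁ h₂ he₁ he₂⟩

end CWPaper
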